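/- Let c > 0, set δ = c/10 and r = ⌊δ^{-2}⌋ + 1, and suppose that for each positive integer N we are given a set E_N ⊂ ℤ ∩ [1, N] with |E_N| < N^{1−c}. Then for every sufficiently large positive integer q there exist distinct primes p_1, …, p_r, each coprime to q and satisfying q^δ/2 < p_i ≤ q^δ, such that: (i) q·p_1⋯p_r ∉ E_{⌈q^{1+rδ}⌉}, and (ii) for every nonempty subset I ⊂ {1, …, r}, ∏_{i∈I} p_i ∉ E_{⌈q^{δ|I|}⌉}. -/

import Mathlib

open Finset in
/-- The central binomial coefficient is bounded by the contributions of the primes up to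
`√(2n)`, those up to `2n/3`, and those in `(n, 2n]`. -/
theorem centralBinom_le_mul_pow_card_primes {n : ℕ} (hn : 2 < n) :
    n.centralBinom ≤ (2 * n) ^ Nat.sqrt (2 * n) * 4 ^ (2 * n / 3) *
      (2 * n) ^ #{p ∈ Ioc n (2 * n) | p.Prime} := by
  set f : ℕ → ℕ := fun p => p ^ n.centralBinom.factorization p with hf
  have h2n : 0 < 2 * n := by lia
  have hfle (p : ℕ) : f p ≤ 2 * n := Nat.pow_factorization_choose_le h2n
  have hsub : ({p ∈ Icc 1 (Nat.sqrt (2 * n)) | p.Prime} ∪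
      {p ∈ Ioc (Nat.sqrt (2 * n)) (2 * n / 3) | p.Prime}) ∪ {p ∈ Ioc n (2 * n) | p.Prime} ⊆
      range (2 * n + 1) := by
    intro p hp
    have := Nat.sqrt_le_self (2 * n)
    simp only [mem_union, mem_filter, mem_Icc, mem_Ioc, mem_range] at hp ⊢
    lia
  have hprod := prod_subset (f := f) hsub (by
    intro p hp hp'
    simp only [mem_union, mem_filter, mem_Icc, mem_Ioc, mem_range] at hp hp'
    by_cases hpp : p.Prime
    · have := hpp.one_lt
      have h0 : n.centralBinom.factorization p = 0 :=
        Nat.factorization_centralBinom_of_two_mul_self_lt_three_mul hn (by grind) (by grind)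
      simp [hf, h0]
    · simp [hf, Nat.factorization_eq_zero_of_not_prime _ hpp])
  have hone (p : ℕ) (hp : p.Prime) : 1 ≤ f p := Nat.one_le_pow _ _ hp.pos
  have hunion (s t : Finset ℕ) (ht : ∀ p ∈ t, p.Prime) :
      ∏ p ∈ s ∪ t, f p ≤ (∏ p ∈ s, f p) * ∏ p ∈ t, f p := by
    rw [← prod_union_inter]
    exact Nat.le_mul_of_pos_right _ (prod_pos fun p hp => hone p (ht p (mem_inter.1 hp).2))
  rw [← Nat.prod_pow_factorization_centralBinom n, ← hprod]
  refine (hunion _ _ fun p hp => (mem_filter.1 hp).2).trans ?_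
  refine Nat.mul_le_mul ((hunion _ _ fun p hp => (mem_filter.1 hp).2).trans
    (Nat.mul_le_mul ?_ ?_)) (prod_le_pow_card _ _ _ fun p _ => hfle p)
  · refine (prod_le_pow_card _ _ _ fun p _ => hfle p).trans (Nat.pow_le_pow_right h2n ?_)
    exact (card_filter_le _ _).trans (by simp)
  · refine le_trans ?_ (primorial_le_four_pow (2 * n / 3))
    have hle : ∀ p ∈ ({p ∈ Ioc (Nat.sqrt (2 * n)) (2 * n / 3) | p.Prime} : Finset ℕ), f p ≤ p := by
      intro p hp
      simp only [mem_filter, mem_Ioc] at hp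
      exact (Nat.pow_le_pow_right hp.2.pos
        (Nat.factorization_choose_le_one (Nat.sqrt_lt'.1 hp.1.1))).trans (pow_one p).le
    refine (prod_le_prod' hle).trans ?_
    refine prod_le_prod_of_subset_of_one_le' (fun p hp => ?_) fun p hp _ => ?_
    · simp only [mem_filter, mem_Ioc] at hp
      exact Nat.mem_primesLE.2 ⟨hp.1.2, hp.2⟩
    · exact (Nat.prime_of_mem_primesLE hp).one_lt.le

open Finset in
/-- A Chebyshev-type lower bound for the number of primes in `(n, 2n]`. -/
theorem mul_log_four_le_card_primes_mul_log {n : ℕ} (hn : 4 ≤ n) :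
    n / 3 * Real.log 4 ≤
      (#{p ∈ Ioc n (2 * n) | p.Prime} + √(2 * n) + 1) * Real.log (2 * n) := by
  set T := #{p ∈ Ioc n (2 * n) | p.Prime}
  have h : 4 ^ n ≤ (2 * n) * ((2 * n) ^ Nat.sqrt (2 * n) * 4 ^ (2 * n / 3) * (2 * n) ^ T) :=
    (Nat.four_pow_lt_mul_centralBinom n hn).le.trans
      (Nat.mul_le_mul (by lia) (centralBinom_le_mul_pow_card_primes (by lia)))
  have hn0 : (0 : ℝ) < 2 * n := by positivity
  have h' : (4 : ℝ) ^ n ≤ (2 * n) * ((2 * n) ^ Nat.sqrt (2 * n) * 4 ^ (2 * n / 3) * (2 * n) ^ T) :=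
    by exact_mod_cast h
  have hlog := Real.log_le_log (by positivity) h'
  rw [Real.log_mul hn0.ne' (by positivity), Real.log_mul (by positivity) (pow_pos hn0 T).ne',
    Real.log_mul (pow_pos hn0 _).ne' (by positivity), Real.log_pow, Real.log_pow, Real.log_pow,
    Real.log_pow] at hlog
  have h1 : ((2 * n / 3 : ℕ) : ℝ) ≤ 2 * n / 3 := by
    simpa using Nat.cast_div_le (α := ℝ) (m := 2 * n) (n := 3)
  have h2 : (Nat.sqrt (2 * n) : ℝ) ≤ √(2 * n) := by
    exact_mod_cast Real.nat_sqrt_le_real_sqrt (a := 2 * n)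
  have h3 : 0 ≤ Real.log (2 * n) := Real.log_nonneg (by norm_cast; lia)
  have h4 : 0 ≤ Real.log 4 := Real.log_nonneg (by norm_num)
  nlinarith [mul_le_mul_of_nonneg_right h1 h4, mul_le_mul_of_nonneg_right h2 h3]

open Finset Filter Asymptotics in
/-- The number of primes in `(x/2, x]` eventually exceeds every function of order `o(x / log x)`. -/
theorem eventually_le_card_primes_half {g : ℝ → ℝ}
    (hg : (fun x => g x * Real.log x) =o[atTop] fun x => x) :
    ∀ᶠ x : ℝ in atTop, g x ≤ #{p ∈ Ioc ⌊x / 2⌋₊ ⌊x⌋₊ | p.Prime} := by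
  have hsqrt : (fun x : ℝ => √x * Real.log x) =o[atTop] fun x => x := by
    have h := (isBigO_refl (fun x : ℝ => √x) atTop).mul_isLittleO
      (isLittleO_log_rpow_atTop (r := 1 / 2) (by norm_num))
    refine h.congr' EventuallyEq.rfl ?_
    filter_upwards [eventually_ge_atTop 0] with x hx
    rw [← Real.sqrt_eq_rpow, Real.mul_self_sqrt hx]
  filter_upwards [hg.bound (show (0 : ℝ) < 1 / 60 by norm_num),
    hsqrt.bound (show (0 : ℝ) < 1 / 60 by norm_num),
    Real.isLittleO_log_id_atTop.bound (show (0 : ℝ) < 1 / 60 by norm_num),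
    eventually_ge_atTop 100] with x h1 h2 h3 hx
  set n := ⌊x / 2⌋₊ with hn
  have hxn : x / 2 < n + 1 := Nat.lt_floor_add_one _
  have hnx : (n : ℝ) ≤ x / 2 := Nat.floor_le (by linarith)
  have hn4 : 4 ≤ n := Nat.le_floor (by push_cast; linarith)
  have hmain := mul_log_four_le_card_primes_mul_log hn4
  have hT : #{p ∈ Ioc n (2 * n) | p.Prime} ≤ #{p ∈ Ioc n ⌊x⌋₊ | p.Prime} := by
    refine card_le_card (filter_subset_filter _ (Ioc_subset_Ioc_right (Nat.le_floor ?_)))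
    push_cast; linarith
  have hT' : (#{p ∈ Ioc n (2 * n) | p.Prime} : ℝ) ≤ #{p ∈ Ioc n ⌊x⌋₊ | p.Prime} := by
    exact_mod_cast hT
  have hlogx : 0 < Real.log x := Real.log_pos (by linarith)
  have hlog4 : 1 ≤ Real.log 4 := by
    rw [Real.le_log_iff_exp_le (by norm_num)]
    linarith [Real.exp_one_lt_d9]
  have hn0 : (0 : ℝ) < n := by positivity
  have hlog : Real.log (2 * n) ≤ Real.log x := Real.log_le_log (by positivity) (by linarith)
  have hs : √(2 * n) ≤ √x := Real.sqrt_le_sqrt (by linarith)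
  have hup : (n : ℝ) / 3 * Real.log 4 ≤
      (#{p ∈ Ioc n ⌊x⌋₊ | p.Prime} + √x + 1) * Real.log x := by
    have : 0 ≤ Real.log (2 * n) := Real.log_nonneg (by norm_cast; lia)
    exact hmain.trans (by gcongr)
  have hlow : (n : ℝ) / 3 ≤ n / 3 * Real.log 4 := le_mul_of_one_le_right (by positivity) hlog4
  simp only [Real.norm_eq_abs, id] at h1 h2 h3
  rw [abs_of_pos (show 0 < x by linarith)] at h1 h2 h3
  refine le_of_mul_le_mul_right ?_ hlogx
  linarith [le_abs_self (g x * Real.log x), le_abs_self (√x * Real.log x),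
    le_abs_self (Real.log x)]

open Finset in
/-- A union bound: if few numbers are forbidden, some `r`-element set of primes avoids
the forbidden values both for all its nonempty subproducts and for `q` times its full product. -/
theorem exists_powersetCard_prod_notMem {P : Finset ℕ} (hP : ∀ p ∈ P, p.Prime) {q r : ℕ}
    (hq : 0 < q) (F : ℕ → Finset ℕ) (G : Finset ℕ)
    (h : ∑ k ∈ Icc 1 r, #(F k) * #P ^ (r - k) + #G < (#P).choose r) :
    ∃ A ∈ P.powersetCard r, q * ∏ p ∈ A, p ∉ G ∧
      ∀ B ⊆ A, B.Nonempty → ∏ p ∈ B, p ∉ F #B := by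
  have hinj : ∀ A ⊆ P, ∀ B ⊆ P, ∏ p ∈ A, p = ∏ p ∈ B, p → A = B := by
    intro A hA B hB hAB
    rw [← Nat.primeFactors_prod fun p hp => hP p (hA hp), hAB,
      Nat.primeFactors_prod fun p hp => hP p (hB hp)]
  set bad : ℕ → Finset (Finset ℕ) := fun k => {B ∈ P.powersetCard k | ∏ p ∈ B, p ∈ F k}
  have hbad (k : ℕ) : #(bad k) ≤ #(F k) := by
    refine card_le_card_of_injOn (fun B => ∏ p ∈ B, p) (fun B hB => (mem_filter.1 hB).2) ?_
    intro A hA B hB hAB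
    exact hinj A (mem_powersetCard.1 (mem_filter.1 hA).1).1 B
      (mem_powersetCard.1 (mem_filter.1 hB).1).1 hAB
  set badG : Finset (Finset ℕ) := {A ∈ P.powersetCard r | q * ∏ p ∈ A, p ∈ G}
  have hbadG : #badG ≤ #G := by
    refine card_le_card_of_injOn (fun B => q * ∏ p ∈ B, p) (fun B hB => (mem_filter.1 hB).2) ?_
    intro A hA B hB hAB
    exact hinj A (mem_powersetCard.1 (mem_filter.1 hA).1).1 B
      (mem_powersetCard.1 (mem_filter.1 hB).1).1 (Nat.eq_of_mul_eq_mul_left hq hAB)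
  set ext : ℕ → Finset (Finset ℕ) := fun k =>
    (bad k).biUnion fun B => (P.powersetCard (r - k)).image fun C => B ∪ C
  have hext (k : ℕ) : #(ext k) ≤ #(F k) * #P ^ (r - k) := by
    refine (card_biUnion_le_card_mul _ _ (#P ^ (r - k)) fun B _ => ?_).trans
      (Nat.mul_le_mul_right _ (hbad k))
    refine card_image_le.trans ?_
    rw [card_powersetCard]
    exact Nat.choose_le_pow _ _
  have hlt : #((Icc 1 r).biUnion ext ∪ badG) < #(P.powersetCard r) := by
    rw [card_powersetCard]
    refine lt_of_le_of_lt ((card_union_le _ _).trans (Nat.add_le_add ?_ hbadG)) h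
    exact card_biUnion_le.trans (sum_le_sum fun k _ => hext k)
  obtain ⟨A, hA, hA'⟩ := exists_mem_notMem_of_card_lt_card hlt
  rw [mem_union, not_or] at hA'
  obtain ⟨hAP, hAr⟩ := mem_powersetCard.1 hA
  refine ⟨A, hA, fun hG => hA'.2 (mem_filter.2 ⟨hA, hG⟩), fun B hB hB0 hF => hA'.1 ?_⟩
  refine mem_biUnion.2 ⟨#B, mem_Icc.2 ⟨hB0.card_pos, hAr ▸ card_le_card hB⟩, ?_⟩
  refine mem_biUnion.2 ⟨B, mem_filter.2 ⟨mem_powersetCard.2 ⟨hB.trans hAP, rfl⟩, hF⟩, ?_⟩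
  refine mem_image.2 ⟨A \ B, mem_powersetCard.2 ⟨sdiff_subset.trans hAP, ?_⟩,
    union_sdiff_of_subset hB⟩
  rw [card_sdiff_of_subset hB, hAr]

/-- Rounding up changes `x ^ (1 - c)` by a factor of at most two. -/
theorem natCeil_rpow_one_sub_le {c x : ℝ} (hc : 0 < c) (hx : 1 ≤ x) :
    (⌈x⌉₊ : ℝ) ^ (1 - c) ≤ 2 * x ^ (1 - c) := by
  have hx0 : 0 < x := by linarith
  have hle : x ≤ ⌈x⌉₊ := Nat.le_ceil x
  have hxc : 0 < x ^ (1 - c) := Real.rpow_pos_of_pos hx0 _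
  rcases le_total c 1 with h | h
  · calc (⌈x⌉₊ : ℝ) ^ (1 - c) ≤ (2 * x) ^ (1 - c) :=
          Real.rpow_le_rpow (by positivity) (by linarith [Nat.ceil_lt_add_one hx0.le])
            (by linarith)
      _ = 2 ^ (1 - c) * x ^ (1 - c) := Real.mul_rpow (by norm_num) hx0.le
      _ ≤ 2 ^ (1 : ℝ) * x ^ (1 - c) := by
          gcongr
          · norm_num
          · linarith
      _ = 2 * x ^ (1 - c) := by rw [Real.rpow_one]
  · linarith [Real.rpow_le_rpow_of_nonpos hx0 hle (by linarith : 1 - c ≤ 0)]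

/-- The number of distinct prime factors of `q` is at most `log₂ q`. -/
theorem card_primeFactors_le_log_div {q : ℕ} (hq : 0 < q) :
    (q.primeFactors.card : ℝ) ≤ Real.log q / Real.log 2 := by
  rw [le_div_iff₀ (Real.log_pos one_lt_two), ← Real.log_pow]
  refine Real.log_le_log (by positivity) ?_
  have h : 2 ^ q.primeFactors.card ≤ q :=
    (Finset.pow_card_le_prod _ _ _ fun p hp => (Nat.prime_of_mem_primeFactors hp).two_le).trans
      (Nat.le_of_dvd hq (Nat.prod_primeFactors_dvd q))
  exact_mod_cast h

open Finset Filter Asymptotics in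
/-- For large `q` there are at least `q ^ (δ(1 - η))` primes in `(q^δ/2, q^δ]` coprime to `q`. -/
theorem eventually_rpow_le_card_primes_coprime {δ η : ℝ} (hδ : 0 < δ) (hη : 0 < η) :
    ∀ᶠ q : ℕ in atTop, (q : ℝ) ^ (δ * (1 - η)) ≤
      #{p ∈ Ioc ⌊(q : ℝ) ^ δ / 2⌋₊ ⌊(q : ℝ) ^ δ⌋₊ | p.Prime ∧ p.Coprime q} := by
  have hpow : (fun x : ℝ => x ^ (1 - η) * Real.log x) =o[atTop] fun x => x := by
    have h := (isBigO_refl (fun x : ℝ => x ^ (1 - η)) atTop).mul_isLittleO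
      (isLittleO_log_rpow_atTop hη)
    refine h.congr' EventuallyEq.rfl ?_
    filter_upwards [eventually_gt_atTop 0] with x hx
    rw [← Real.rpow_add hx, sub_add_cancel, Real.rpow_one]
  have hloglog : (fun x : ℝ => Real.log x / (δ * Real.log 2) * Real.log x) =o[atTop]
      fun x => x := by
    have h := ((isLittleO_log_rpow_atTop (r := 1 / 2) (by norm_num)).mul
      (isLittleO_log_rpow_atTop (r := 1 / 2) (by norm_num))).const_mul_left (δ * Real.log 2)⁻¹
    refine h.congr' (.of_eq (by ext x; ring)) ?_
    filter_upwards [eventually_gt_atTop 0] with x hx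
    rw [← Real.rpow_add hx]
    norm_num
  have hcount := eventually_le_card_primes_half
    (g := fun x => x ^ (1 - η) + Real.log x / (δ * Real.log 2))
    ((hpow.add hloglog).congr_left fun x => by ring)
  have htend : Tendsto (fun q : ℕ => (q : ℝ) ^ δ) atTop atTop :=
    (tendsto_rpow_atTop hδ).comp tendsto_natCast_atTop_atTop
  filter_upwards [htend.eventually hcount, eventually_gt_atTop 0] with q hq hq0
  have hq0' : (0 : ℝ) < q := by exact_mod_cast hq0
  rw [← Real.rpow_mul hq0'.le, Real.log_rpow hq0', mul_div_mul_left _ _ hδ.ne'] at hq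
  have hsub : ({p ∈ Ioc ⌊(q : ℝ) ^ δ / 2⌋₊ ⌊(q : ℝ) ^ δ⌋₊ | p.Prime} : Finset ℕ) ⊆
      {p ∈ Ioc ⌊(q : ℝ) ^ δ / 2⌋₊ ⌊(q : ℝ) ^ δ⌋₊ | p.Prime ∧ p.Coprime q} ∪ q.primeFactors := by
    intro p hp
    rw [mem_filter] at hp
    rw [mem_union, mem_filter, Nat.mem_primeFactors]
    rcases Nat.coprime_or_dvd_of_prime hp.2 q with h | h
    · exact .inl ⟨hp.1, hp.2, h⟩
    · exact .inr ⟨hp.2, h, hq0.ne'⟩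
  have hcard : (#{p ∈ Ioc ⌊(q : ℝ) ^ δ / 2⌋₊ ⌊(q : ℝ) ^ δ⌋₊ | p.Prime} : ℝ) ≤
      #{p ∈ Ioc ⌊(q : ℝ) ^ δ / 2⌋₊ ⌊(q : ℝ) ^ δ⌋₊ | p.Prime ∧ p.Coprime q} +
        #q.primeFactors := by
    exact_mod_cast (card_le_card hsub).trans (card_union_le _ _)
  linarith [card_primeFactors_le_log_div hq0]

/-- The polynomial lower bound for a binomial coefficient used in the union bound. -/
theorem half_pow_le_factorial_mul_choose {n r : ℕ} (h : 2 * r ≤ n) :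
    ((n : ℝ) / 2) ^ r ≤ r.factorial * n.choose r := by
  have h1 : (((n + 1 - r) ^ r : ℕ) : ℝ) ≤ r.factorial * n.choose r := by
    rw [← Nat.cast_mul, ← Nat.descFactorial_eq_factorial_mul_choose]
    exact_mod_cast Nat.pow_sub_le_descFactorial n r
  refine le_trans ?_ h1
  rw [Nat.cast_pow]
  gcongr
  rw [div_le_iff₀ two_pos]
  norm_cast
  lia

open Finset in
/-- The weighted count of forbidden values is smaller than the number of `r`-element subsets of
a set of size `T ≥ q ^ (δ(1 - c/2))`. -/
theorem sum_mul_pow_add_lt_choose {c δ : ℝ} {q r T g : ℕ} {f : ℕ → ℕ} (hδ : 0 < δ) (hc : 0 < c)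
    (hq : 1 ≤ (q : ℝ)) (hr : 1 ≤ r * δ * c / 2) (hrT : 2 * r ≤ T)
    (hT : (q : ℝ) ^ (δ * (1 - c / 2)) ≤ T)
    (hf : ∀ k ∈ Icc 1 r, (f k : ℝ) ≤ 2 * ((q : ℝ) ^ (δ * k)) ^ (1 - c))
    (hg : (g : ℝ) ≤ 2 * ((q : ℝ) ^ (1 + r * δ)) ^ (1 - c))
    (hsmall : 2 ^ r * r.factorial *
      (2 * r * (q : ℝ) ^ (-(δ * c / 2)) + 2 * (q : ℝ) ^ (-c)) < 1) :
    ∑ k ∈ Icc 1 r, f k * T ^ (r - k) + g < T.choose r := by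
  have hq0 : (0 : ℝ) < q := by linarith
  have hT0 : (0 : ℝ) < T := (Real.rpow_pos_of_pos hq0 _).trans_le hT
  have hTpow (k : ℕ) : (q : ℝ) ^ (δ * (1 - c / 2) * k) ≤ (T : ℝ) ^ k := by
    rw [Real.rpow_mul hq0.le, Real.rpow_natCast]
    gcongr
  have hterm : ∀ k ∈ Icc 1 r,
      (f k : ℝ) * T ^ (r - k) ≤ 2 * (q : ℝ) ^ (-(δ * c / 2)) * T ^ r := by
    intro k hk
    obtain ⟨hk1, hkr⟩ := mem_Icc.1 hk
    have hk1' : (1 : ℝ) ≤ k := by exact_mod_cast hk1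
    have hexp : ((q : ℝ) ^ (δ * k)) ^ (1 - c) ≤ (q : ℝ) ^ (-(δ * c / 2)) * T ^ k := by
      calc ((q : ℝ) ^ (δ * k)) ^ (1 - c)
          = (q : ℝ) ^ (-(δ * c / 2) * k) * (q : ℝ) ^ (δ * (1 - c / 2) * k) := by
            rw [← Real.rpow_mul hq0.le, ← Real.rpow_add hq0]
            ring_nf
        _ ≤ (q : ℝ) ^ (-(δ * c / 2)) * T ^ k := by
            refine mul_le_mul (Real.rpow_le_rpow_of_exponent_le hq ?_) (hTpow k)
              (by positivity) (by positivity)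
            nlinarith [mul_pos hδ hc]
    calc (f k : ℝ) * T ^ (r - k)
        ≤ 2 * ((q : ℝ) ^ (-(δ * c / 2)) * T ^ k) * T ^ (r - k) := by
          have := hf k hk
          gcongr
          linarith
      _ = 2 * (q : ℝ) ^ (-(δ * c / 2)) * T ^ r := by
          rw [← Nat.add_sub_of_le hkr, pow_add, Nat.add_sub_cancel_left]
          ring
  have hlast : (g : ℝ) ≤ 2 * (q : ℝ) ^ (-c) * T ^ r := by
    have hexp : ((q : ℝ) ^ (1 + r * δ)) ^ (1 - c) ≤ (q : ℝ) ^ (-c) * T ^ r := by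
      calc ((q : ℝ) ^ (1 + r * δ)) ^ (1 - c)
          = (q : ℝ) ^ (1 - c - r * δ * c / 2) * (q : ℝ) ^ (δ * (1 - c / 2) * r) := by
            rw [← Real.rpow_mul hq0.le, ← Real.rpow_add hq0]
            ring_nf
        _ ≤ (q : ℝ) ^ (-c) * T ^ r := by
            refine mul_le_mul (Real.rpow_le_rpow_of_exponent_le hq (by linarith)) (hTpow r)
              (by positivity) (by positivity)
    linarith
  have hsum : ∑ k ∈ Icc 1 r, (f k : ℝ) * T ^ (r - k) ≤
      r * (2 * (q : ℝ) ^ (-(δ * c / 2)) * T ^ r) := by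
    simpa using sum_le_card_nsmul _ _ _ hterm
  have hchoose := half_pow_le_factorial_mul_choose hrT
  have hTr : (0 : ℝ) < (T : ℝ) ^ r := by positivity
  rw [← Nat.cast_lt (α := ℝ)]
  push_cast
  have hfac : (0 : ℝ) < 2 ^ r * r.factorial := by positivity
  refine lt_of_mul_lt_mul_left ?_ hfac.le
  calc (2 ^ r * r.factorial : ℝ) * (∑ k ∈ Icc 1 r, (f k : ℝ) * T ^ (r - k) + g)
      ≤ 2 ^ r * r.factorial *
          (r * (2 * (q : ℝ) ^ (-(δ * c / 2)) * T ^ r) + 2 * (q : ℝ) ^ (-c) * T ^ r) := by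
        gcongr
    _ = 2 ^ r * r.factorial *
          (2 * r * (q : ℝ) ^ (-(δ * c / 2)) + 2 * (q : ℝ) ^ (-c)) * T ^ r := by ring
    _ < 1 * T ^ r := by gcongr
    _ = 2 ^ r * ((T : ℝ) / 2) ^ r := by rw [div_pow]; field_simp
    _ ≤ 2 ^ r * r.factorial * T.choose r := by
        rw [mul_assoc]
        gcongr


/-- Auxiliary continued fraction algorithm with fuel: for `x ∈ (0,1)`,
produces the list of partial quotients `[a₁, …, aₙ]` of `x = [0; a₁, …, aₙ]`. -/
def cfListAux : ℕ → ℚ → List ℕ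
  | 0, _ => []
  | (n + 1), x => if x = 0 then [] else ⌊x⁻¹⌋.toNat :: cfListAux n (x⁻¹ - (⌊x⁻¹⌋ : ℚ))

/-- The (canonical) list of partial quotients of a rational `x ∈ (0,1)`:
`x = [0; a₁, …, aₙ]` with each `aᵢ` a positive integer and `aₙ ≥ 2`.
The denominator of `x` is a valid fuel bound since denominators strictly decrease. -/
def cfList (x : ℚ) : List ℕ := cfListAux x.den x

/-- `S x` is the sum of the partial quotients of the rational `x ∈ (0,1)`. -/
def S (x : ℚ) : ℕ := (cfList x).sum

/-- `RA A` is the set of rationals in `(0,1)` all of whose partial quotients are `≤ A`. -/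
def RA (A : ℕ) : Set ℚ := {x | 0 < x ∧ x < 1 ∧ ∀ a ∈ cfList x, a ≤ A}

/-- `RepCost y n` : the rational `y` admits a representation as a finite signed sum
`y = Σ_α ε_α · x_α` with `ε_α ∈ {+1, -1}`, each `x_α = b_α/q_α ∈ (0,1)` in lowest terms,
and total partial-quotient cost `Σ_α S(x_α) = n`. -/
def RepCost (y : ℚ) (n : ℕ) : Prop :=
  ∃ (k : ℕ) (ε : Fin k → ℤ) (x : Fin k → ℚ),
    (∀ i, ε i = 1 ∨ ε i = -1) ∧ (∀ i, 0 < x i ∧ x i < 1) ∧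
    y = ∑ i, (ε i : ℚ) * x i ∧ n = ∑ i, S (x i)

/-- `CostLE y t` : the minimal representation cost `Ĉ(y)` is at most `t`. -/
def CostLE (y : ℚ) (t : ℝ) : Prop := ∃ n : ℕ, RepCost y n ∧ (n : ℝ) ≤ t
/-- the prime-selection step (3.5)–(3.6) of the paper. Given `c > 0`,
`δ = c/10`, `r = ⌊δ⁻²⌋ + 1`, and exceptional sets `E_N ⊆ [1,N]` with `|E_N| < N^{1-c}`,
for every sufficiently large `q` there are distinct primes `p₁, …, p_r`, coprime to `q`,
with `q^δ/2 < pᵢ ≤ q^δ`, such that `q·p₁⋯p_r ∉ E_{⌈q^{1+rδ}⌉}` and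
`∏_{i∈I} pᵢ ∉ E_{⌈q^{δ|I|}⌉}` for every nonempty `I ⊆ {1, …, r}`. -/
theorem statement9 (c : ℝ) (hc : 0 < c) (δ : ℝ) (hδ : δ = c / 10)
    (r : ℕ) (hr : r = ⌊(δ ^ 2)⁻¹⌋₊ + 1)
    (E : ℕ → Set ℕ)
    (hE : ∀ N : ℕ, 0 < N → E N ⊆ Set.Icc 1 N ∧ ((E N).ncard : ℝ) < (N : ℝ) ^ ((1 : ℝ) - c)) :
    ∀ᶠ q : ℕ in Filter.atTop,
      ∃ p : Fin r → ℕ, Function.Injective p ∧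
        (∀ i, (p i).Prime ∧ Nat.Coprime (p i) q ∧
          (q : ℝ) ^ δ / 2 < (p i : ℝ) ∧ (p i : ℝ) ≤ (q : ℝ) ^ δ) ∧
        q * ∏ i, p i ∉ E ⌈(q : ℝ) ^ ((1 : ℝ) + r * δ)⌉₊ ∧
        ∀ I : Finset (Fin r), I.Nonempty →
          (∏ i ∈ I, p i) ∉ E ⌈(q : ℝ) ^ (δ * I.card)⌉₊ := by
  have hδ0 : 0 < δ := by rw [hδ]; positivity
  have hr' : 1 ≤ r * δ * c / 2 := by
    have h1 : (δ ^ 2)⁻¹ < r := by rw [hr]; exact_mod_cast Nat.lt_floor_add_one _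
    have h2 : 1 < r * δ ^ 2 := by rwa [inv_lt_iff_one_lt_mul₀ (by positivity)] at h1
    have h3 : c = 10 * δ := by linarith
    rw [h3]
    nlinarith
  have hfin (x : ℝ) (hx : 1 ≤ x) : (E ⌈x⌉₊).Finite ∧
      ((E ⌈x⌉₊).ncard : ℝ) ≤ 2 * x ^ (1 - c) := by
    obtain ⟨h1, h2⟩ := hE ⌈x⌉₊ (Nat.ceil_pos.2 (by linarith))
    exact ⟨(Set.finite_Icc _ _).subset h1, h2.le.trans (natCeil_rpow_one_sub_le hc hx)⟩
  have hcast : Filter.Tendsto (fun q : ℕ => (q : ℝ)) Filter.atTop Filter.atTop :=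
    tendsto_natCast_atTop_atTop
  have hneg {a : ℝ} (ha : 0 < a) :
      Filter.Tendsto (fun q : ℕ => (q : ℝ) ^ (-a)) Filter.atTop (nhds 0) :=
    (tendsto_rpow_neg_atTop ha).comp hcast
  have hsmall : ∀ᶠ q : ℕ in Filter.atTop, (2 : ℝ) ^ r * r.factorial *
      (2 * r * (q : ℝ) ^ (-(δ * c / 2)) + 2 * (q : ℝ) ^ (-c)) < 1 := by
    have h := (((hneg (show 0 < δ * c / 2 by positivity)).const_mul (2 * (r : ℝ))).add
      ((hneg hc).const_mul 2)).const_mul ((2 : ℝ) ^ r * r.factorial)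
    exact h.eventually_lt_const (by norm_num)
  set η := min (c / 2) (1 / 2) with hη
  have hη0 : 0 < η := by positivity
  have hlarge : ∀ᶠ q : ℕ in Filter.atTop, (2 * r : ℝ) ≤ (q : ℝ) ^ (δ * (1 - η)) := by
    have hη1 : 0 < 1 - η := by linarith [min_le_right (c / 2) (1 / 2 : ℝ)]
    exact ((tendsto_rpow_atTop (mul_pos hδ0 hη1)).comp hcast).eventually_ge_atTop _
  filter_upwards [hsmall, hlarge, eventually_rpow_le_card_primes_coprime hδ0 hη0,
    Filter.eventually_ge_atTop 1] with q hq_small hq_large hq_card hq1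
  have hq1' : (1 : ℝ) ≤ q := by exact_mod_cast hq1
  set P : Finset ℕ := {p ∈ Finset.Ioc ⌊(q : ℝ) ^ δ / 2⌋₊ ⌊(q : ℝ) ^ δ⌋₊ |
    p.Prime ∧ p.Coprime q} with hP
  have hPprime : ∀ p ∈ P, p.Prime := fun p hp => (Finset.mem_filter.1 hp).2.1
  have hpow (a : ℝ) (ha : 0 ≤ a) : 1 ≤ (q : ℝ) ^ a := Real.one_le_rpow hq1' ha
  have hF (k : ℕ) := hfin ((q : ℝ) ^ (δ * k)) (hpow _ (by positivity))
  have hG := hfin ((q : ℝ) ^ (1 + r * δ)) (hpow _ (by positivity))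
  have hcount := sum_mul_pow_add_lt_choose (T := P.card) (f := fun k => (hF k).1.toFinset.card)
    (g := hG.1.toFinset.card) hδ0 hc hq1' hr' (by exact_mod_cast hq_large.trans hq_card)
    ((Real.rpow_le_rpow_of_exponent_le hq1' (by
      have := min_le_left (c / 2) (1 / 2 : ℝ)
      gcongr)).trans hq_card)
    (fun k _ => by rw [← Set.ncard_eq_toFinset_card _ (hF k).1]; exact (hF k).2)
    (by rw [← Set.ncard_eq_toFinset_card _ hG.1]; exact hG.2) hq_small
  obtain ⟨A, hA, hAG, hAF⟩ := exists_powersetCard_prod_notMem hPprime hq1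
    (fun k => (hF k).1.toFinset) hG.1.toFinset hcount
  obtain ⟨hAP, hAr⟩ := Finset.mem_powersetCard.1 hA
  set p := A.orderEmbOfFin hAr with hp
  have himage (I : Finset (Fin r)) : ∏ x ∈ I.map p.toEmbedding, x = ∏ i ∈ I, p i := by
    simp
  refine ⟨p, p.injective, fun i => ?_, ?_, fun I hI => ?_⟩
  · have hmem := hAP (A.orderEmbOfFin_mem hAr i)
    rw [hP, Finset.mem_filter, Finset.mem_Ioc, Nat.floor_lt (by positivity),
      Nat.le_floor_iff (by positivity)] at hmem
    exact ⟨hmem.2.1, hmem.2.2, hmem.1⟩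
  · have huniv : Finset.univ.map p.toEmbedding = A := A.map_orderEmbOfFin_univ hAr
    rw [← himage, huniv]
    simpa using hAG
  · have h := hAF (I.map p.toEmbedding) (fun x hx => by
      obtain ⟨i, -, rfl⟩ := Finset.mem_map.1 hx
      exact A.orderEmbOfFin_mem hAr i) (hI.map)
    rw [himage, Finset.card_map] at h
    simpa using h
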